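/- Let n ≥ 1. The composite map η̂ ∘ ι, sending each p ∈ T_n to the two-dimensional binary word η̂(ι(p)) of dimension 2 × n, is a bijection from T_n onto W_n, the set of primitive two-dimensional binary words of dimension 2 × n. -/

import Mathlib

open scoped BigOperators

noncomputable section

/-- A word `w : Fin n → Fin 4` is primitive if it is not a proper power,
i.e. there is no `d` with `0 < d < n`, `d ∣ n`, and `w j = w (j mod d)` for all `j`. -/
def Prim1D (n : ℕ) (w : Fin n → Fin 4) : Prop :=
  ¬ ∃ (d : ℕ) (hd : 0 < d) (hdn : d < n), d ∣ n ∧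
      ∀ j : Fin n, w j = w ⟨j.val % d, Nat.lt_trans (Nat.mod_lt _ hd) hdn⟩

/-- A two-dimensional binary word `W : Fin 2 → Fin n → Fin 2` is primitive if there are no
positive `p ∣ 2` and `q ∣ n` with `(p, q) ≠ (2, n)` such that
`W i j = W (i mod p) (j mod q)` for all `i, j`. -/
def Prim2D (n : ℕ) (W : Fin 2 → Fin n → Fin 2) : Prop :=
  ¬ ∃ (p q : ℕ) (hp : 0 < p) (hq : 0 < q) (hpd : p ∣ 2) (hqd : q ∣ n),
      (p ≠ 2 ∨ q ≠ n) ∧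
      ∀ (i : Fin 2) (j : Fin n),
        W i j = W ⟨i.val % p, Nat.lt_of_lt_of_le (Nat.mod_lt _ hp)
                      (Nat.le_of_dvd (by norm_num) hpd)⟩
                  ⟨j.val % q, Nat.lt_of_lt_of_le (Nat.mod_lt _ hq)
                      (Nat.le_of_dvd j.pos hqd)⟩

/-- The substitution `η` sending each symbol of `Γ = {0, 1, 2, 3}` to a column of height 2:
`0 ↦ (0,1)`, `1 ↦ (0,0)`, `2 ↦ (1,1)`, `3 ↦ (1,0)` (read top-to-bottom). -/
def eta : Fin 4 → Fin 2 → Fin 2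
  | 0 => ![0, 1]
  | 1 => ![0, 0]
  | 2 => ![1, 1]
  | 3 => ![1, 0]

/-- The extension `η̂` of `η` sending a word `w : Fin n → Fin 4` to the `2 × n`
two-dimensional binary word whose `j`-th column is `η (w j)`. -/
def etaHat {n : ℕ} (w : Fin n → Fin 4) : Fin 2 → Fin n → Fin 2 :=
  fun i j => eta (w j) i

/-- `U_n`: primitive words of length `n` over `Γ = {0,1,2,3}` containing a `0` or a `3`. -/
def Uset (n : ℕ) : Set (Fin n → Fin 4) :=
  {w | Prim1D n w ∧ ∃ j : Fin n, w j = 0 ∨ w j = 3}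

/-- `W_n`: primitive two-dimensional binary words of dimension `2 × n`. -/
def Wset (n : ℕ) : Set (Fin 2 → Fin n → Fin 2) :=
  {W | Prim2D n W}

/-- `C̄`: sorted triples `(a, b, c)` with `a ≥ b ≥ c ≥ 0` and `a + b + c = 1`. -/
def Cbar : Set (ℝ × ℝ × ℝ) :=
  {p | p.1 ≥ p.2.1 ∧ p.2.1 ≥ p.2.2 ∧ p.2.2 ≥ 0 ∧ p.1 + p.2.1 + p.2.2 = 1}

/-- `C`: non-degenerate sorted triples `(a, b, c)` with `a ≥ b ≥ c > 0` and `a + b + c = 1`. -/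
def Cset : Set (ℝ × ℝ × ℝ) :=
  {p | p.1 ≥ p.2.1 ∧ p.2.1 ≥ p.2.2 ∧ p.2.2 > 0 ∧ p.1 + p.2.1 + p.2.2 = 1}

/-- `C*`: the sorted triples in `C` with `a ≠ 1/2`. -/
def Cstar : Set (ℝ × ℝ × ℝ) :=
  {p ∈ Cset | p.1 ≠ 1/2}

/-- The four regions `R₀, R₁, R₂, R₃` partitioning `C*`. -/
def Rset : Fin 4 → Set (ℝ × ℝ × ℝ)
  | 0 => {p ∈ Cstar | p.1 < 1/2}
  | 1 => {p ∈ Cstar | p.1 > 1/2 ∧ 2*p.1 - 1 ≥ 2*p.2.1}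
  | 2 => {p ∈ Cstar | p.1 > 1/2 ∧ 2*p.2.1 > 2*p.1 - 1 ∧ 2*p.1 - 1 ≥ 2*p.2.2}
  | 3 => {p ∈ Cstar | p.1 > 1/2 ∧ 2*p.2.2 > 2*p.1 - 1}

/-- The sorted pedal map `P` (extended to a total map on `ℝ³` by the same case analysis;
on `R₀, R₁, R₂, R₃` it is given by the four branch formulas). -/
def pedal (p : ℝ × ℝ × ℝ) : ℝ × ℝ × ℝ :=
  if p.1 < 1/2 then (1 - 2*p.2.2, 1 - 2*p.2.1, 1 - 2*p.1)
  else if 2*p.1 - 1 ≥ 2*p.2.1 then (2*p.1 - 1, 2*p.2.1, 2*p.2.2)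
  else if 2*p.1 - 1 ≥ 2*p.2.2 then (2*p.2.1, 2*p.1 - 1, 2*p.2.2)
  else (2*p.2.1, 2*p.2.2, 2*p.1 - 1)

/-- The four inverse branches `I₀, I₁, I₂, I₃` of the sorted pedal map. -/
def Ibr : Fin 4 → ℝ × ℝ × ℝ → ℝ × ℝ × ℝ
  | 0, p => ((1 - p.2.2)/2, (1 - p.2.1)/2, (1 - p.1)/2)
  | 1, p => ((p.1 + 1)/2, p.2.1/2, p.2.2/2)
  | 2, p => ((p.2.1 + 1)/2, p.1/2, p.2.2/2)
  | 3, p => ((p.2.2 + 1)/2, p.1/2, p.2.1/2)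

/-- The composed inverse branch `I_w = I_{w₀} ∘ I_{w₁} ∘ ⋯ ∘ I_{w_{m−1}}`
(composition applied from right to left). -/
def Icomp : (m : ℕ) → (Fin m → Fin 4) → ℝ × ℝ × ℝ → ℝ × ℝ × ℝ
  | 0, _, p => p
  | m + 1, w, p => Ibr (w 0) (Icomp m (fun j => w j.succ) p)

/-- The Euclidean distance on `ℝ³` (represented as `ℝ × ℝ × ℝ`). -/
def eudist (p q : ℝ × ℝ × ℝ) : ℝ :=
  Real.sqrt ((p.1 - q.1)^2 + (p.2.1 - q.2.1)^2 + (p.2.2 - q.2.2)^2)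

/-- `T_n`: sorted triples of exact pedal period `n`. -/
def Tset (n : ℕ) : Set (ℝ × ℝ × ℝ) :=
  {p | p ∈ Cset ∧ (∀ j, j < n → pedal^[j] p ∈ Cstar) ∧ pedal^[n] p = p ∧
       ∀ d, 1 ≤ d → d < n → pedal^[d] p ≠ p}

/-- `w : Fin n → Fin 4` is the branch itinerary of `p`: `P^j(p) ∈ R_{w_j}` for `0 ≤ j < n`. -/
def Itinerary (n : ℕ) (p : ℝ × ℝ × ℝ) (w : Fin n → Fin 4) : Prop :=
  ∀ j : Fin n, pedal^[j.val] p ∈ Rset (w j)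

/-- Squared Euclidean distance on triples. -/
def sqDist (p q : ℝ × ℝ × ℝ) : ℝ :=
  (p.1 - q.1) ^ 2 + (p.2.1 - q.2.1) ^ 2 + (p.2.2 - q.2.2) ^ 2

lemma eq_of_sqDist_eq_zero {p q : ℝ × ℝ × ℝ} (h : sqDist p q = 0) : p = q := by
  obtain ⟨a, b, c⟩ := p
  obtain ⟨a', b', c'⟩ := q
  simp only [sqDist] at h
  have h1 : a - a' = 0 := by
    apply pow_eq_zero_iff (two_ne_zero) |>.1
    nlinarith [sq_nonneg (a - a'), sq_nonneg (b - b'), sq_nonneg (c - c')]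
  have h2 : b - b' = 0 := by
    apply pow_eq_zero_iff (two_ne_zero) |>.1
    nlinarith [sq_nonneg (a - a'), sq_nonneg (b - b'), sq_nonneg (c - c')]
  have h3 : c - c' = 0 := by
    apply pow_eq_zero_iff (two_ne_zero) |>.1
    nlinarith [sq_nonneg (a - a'), sq_nonneg (b - b'), sq_nonneg (c - c')]
  rw [sub_eq_zero.1 h1, sub_eq_zero.1 h2, sub_eq_zero.1 h3]

lemma eta_injective : Function.Injective eta := by decide

lemma eta_surjective : Function.Surjective eta := by decide

lemma eta_zero_eq_eta_one_iff (i : Fin 4) : eta i 0 = eta i 1 ↔ i = 1 ∨ i = 2 := by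
  revert i; decide

lemma Rset_subset_Cstar (i : Fin 4) : Rset i ⊆ Cstar := by
  fin_cases i <;> exact fun p hp => hp.1

lemma exists_mem_Rset {p : ℝ × ℝ × ℝ} (hp : p ∈ Cstar) : ∃ i, p ∈ Rset i := by
  rcases lt_or_gt_of_ne hp.2 with h | h
  · exact ⟨0, hp, h⟩
  · by_cases h1 : 2 * p.1 - 1 ≥ 2 * p.2.1
    · exact ⟨1, hp, h, h1⟩
    · by_cases h2 : 2 * p.1 - 1 ≥ 2 * p.2.2
      · exact ⟨2, hp, h, not_le.1 h1, h2⟩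
      · exact ⟨3, hp, h, not_le.1 h2⟩

lemma Rset_unique {p : ℝ × ℝ × ℝ} {i j : Fin 4} (hi : p ∈ Rset i) (hj : p ∈ Rset j) :
    i = j := by
  have hC := (Rset_subset_Cstar i hi).1
  obtain ⟨-, hbc, -, -⟩ := hC
  fin_cases i <;> fin_cases j <;> first
    | rfl
    | (exfalso
       simp only [Rset, Set.mem_ofPred_eq] at hi hj
       obtain ⟨-, hi⟩ := hi
       obtain ⟨-, hj⟩ := hj
       grind)

lemma pedal_eq_of_mem_Rset {p : ℝ × ℝ × ℝ} {i : Fin 4} (hp : p ∈ Rset i) :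
    pedal p = match i with
      | 0 => (1 - 2 * p.2.2, 1 - 2 * p.2.1, 1 - 2 * p.1)
      | 1 => (2 * p.1 - 1, 2 * p.2.1, 2 * p.2.2)
      | 2 => (2 * p.2.1, 2 * p.1 - 1, 2 * p.2.2)
      | 3 => (2 * p.2.1, 2 * p.2.2, 2 * p.1 - 1) := by
  have hC := (Rset_subset_Cstar i hp).1
  obtain ⟨-, hbc, -, -⟩ := hC
  fin_cases i <;> simp only [Rset, Set.mem_ofPred_eq] at hp <;> obtain ⟨-, hp⟩ := hp <;>
    simp only [pedal] <;> grind

lemma sqDist_pedal {p q : ℝ × ℝ × ℝ} {i : Fin 4} (hp : p ∈ Rset i) (hq : q ∈ Rset i) :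
    sqDist (pedal p) (pedal q) = 4 * sqDist p q := by
  rw [pedal_eq_of_mem_Rset hp, pedal_eq_of_mem_Rset hq]
  fin_cases i <;> simp only [sqDist] <;> ring

/-- Two points of period `n` with the same itinerary coincide, since each branch of the pedal
map doubles distances. -/
lemma eq_of_itinerary_eq {n : ℕ} (hn : 1 ≤ n) {p q : ℝ × ℝ × ℝ} {w : Fin n → Fin 4}
    (hp : Itinerary n p w) (hq : Itinerary n q w) (hpn : pedal^[n] p = p)
    (hqn : pedal^[n] q = q) : p = q := by
  have key : ∀ k ≤ n, sqDist (pedal^[k] p) (pedal^[k] q) = 4 ^ k * sqDist p q := by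
    intro k
    induction k with
    | zero => simp
    | succ k ih =>
      intro hk
      rw [Function.iterate_succ_apply', Function.iterate_succ_apply',
        sqDist_pedal (hp ⟨k, hk⟩) (hq ⟨k, hk⟩), ih (by omega), pow_succ]
      ring
  have h := key n le_rfl
  rw [hpn, hqn] at h
  have h4 : (1 : ℝ) < 4 ^ n := one_lt_pow₀ (by norm_num) (by omega)
  apply eq_of_sqDist_eq_zero
  have h0 : ((4 : ℝ) ^ n - 1) * sqDist p q = 0 := by linarith
  exact (mul_eq_zero.1 h0).resolve_left (by linarith)

lemma Prim2D.not_periodic {n : ℕ} {w : Fin n → Fin 4} (h : Prim2D n (etaHat w)) {q : ℕ}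
    (hq : 0 < q) (hqn : q < n) (hd : q ∣ n)
    (hw : ∀ j : Fin n, w j = w ⟨j.val % q, (Nat.mod_lt _ hq).trans hqn⟩) : False := by
  refine h ⟨2, q, two_pos, hq, dvd_rfl, hd, Or.inr hqn.ne, fun i j => ?_⟩
  have hi : (⟨i.val % 2, Nat.mod_lt _ two_pos⟩ : Fin 2) = i :=
    Fin.ext (Nat.mod_eq_of_lt i.isLt)
  simp only [etaHat, hi]
  rw [hw j]

lemma Prim2D.exists_eq_zero_or_three {n : ℕ} (hn : 1 ≤ n) {w : Fin n → Fin 4}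
    (h : Prim2D n (etaHat w)) : ∃ j, w j = 0 ∨ w j = 3 := by
  by_contra! hw
  refine h ⟨1, n, one_pos, hn, one_dvd _, dvd_rfl, Or.inl (by norm_num), fun i j => ?_⟩
  have hj : (⟨j.val % n, Nat.mod_lt _ hn⟩ : Fin n) = j := Fin.ext (Nat.mod_eq_of_lt j.isLt)
  have hrow : eta (w j) 0 = eta (w j) 1 := by
    rw [eta_zero_eq_eta_one_iff]
    have := hw j
    revert this
    generalize w j = a
    revert a
    decide
  simp only [etaHat, hj]
  fin_cases i
  · rfl
  · exact hrow.symm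

lemma prim2D_etaHat {n : ℕ} {w : Fin n → Fin 4} (h1 : Prim1D n w)
    (h2 : ∃ j, w j = 0 ∨ w j = 3) : Prim2D n (etaHat w) := by
  rintro ⟨p, q, hp, hq, hpd, hqd, hne, hW⟩
  rcases (Nat.dvd_prime Nat.prime_two).1 hpd with rfl | rfl
  · obtain ⟨j, hj⟩ := h2
    have hrow : eta (w j) 0 = eta (w j) 1 := (hW 0 j).trans (hW 1 j).symm
    rw [eta_zero_eq_eta_one_iff] at hrow
    revert hj hrow
    generalize w j = a
    revert a
    decide
  · have hqn : q ≠ n := hne.resolve_left (by simp)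
    obtain ⟨j, -⟩ := h2
    have hlt : q < n := lt_of_le_of_ne (Nat.le_of_dvd j.pos hqd) hqn
    refine h1 ⟨q, hq, hlt, hqd, fun j => eta_injective (funext fun i => ?_)⟩
    have hi : (⟨i.val % 2, Nat.mod_lt _ two_pos⟩ : Fin 2) = i :=
      Fin.ext (Nat.mod_eq_of_lt i.isLt)
    have := hW i j
    simp only [etaHat, hi] at this
    exact this

lemma Itinerary.exists_eq_zero_or_three {n : ℕ} (hn : 1 ≤ n) {p : ℝ × ℝ × ℝ}
    {w : Fin n → Fin 4} (hp : p ∈ Cset) (hpn : pedal^[n] p = p) (hw : Itinerary n p w) :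
    ∃ j, w j = 0 ∨ w j = 3 := by
  by_contra! h
  have key : ∀ k ≤ n, (pedal^[k] p).2.2 = 2 ^ k * p.2.2 := by
    intro k
    induction k with
    | zero => simp
    | succ k ih =>
      intro hk
      have hstep : ∀ i : Fin 4, i ≠ 0 ∧ i ≠ 3 → ∀ x ∈ Rset i, (pedal x).2.2 = 2 * x.2.2 := by
        intro i hi x hx
        rw [pedal_eq_of_mem_Rset hx]
        fin_cases i <;> simp_all
      rw [Function.iterate_succ_apply', hstep _ (h ⟨k, hk⟩) _ (hw ⟨k, hk⟩), ih (by omega),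
        pow_succ]
      ring
  have h0 := key n le_rfl
  rw [hpn] at h0
  have h2 : (1 : ℝ) < 2 ^ n := one_lt_pow₀ (by norm_num) (by omega)
  have hc : p.2.2 > 0 := hp.2.2.1
  nlinarith

lemma Itinerary.prim1D {n : ℕ} {p : ℝ × ℝ × ℝ} {w : Fin n → Fin 4} (hp : p ∈ Tset n)
    (hw : Itinerary n p w) : Prim1D n w := by
  obtain ⟨-, -, hpn, hmin⟩ := hp
  rintro ⟨q, hq, hqn, hd, hper⟩
  have hn : 0 < n := hq.trans hqn
  have hmod : ∀ k, pedal^[k % n] p = pedal^[k] p := Function.IsPeriodicPt.iterate_mod_apply hpn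
  apply hmin q hq hqn
  refine eq_of_itinerary_eq hn (w := w) (fun j => ?_) hw ?_ hpn
  · rw [← Function.iterate_add_apply, ← hmod]
    have h := hw ⟨(j.val + q) % n, Nat.mod_lt _ hn⟩
    rw [hper] at h
    simp only [Nat.mod_mod_of_dvd _ hd, Nat.add_mod_right] at h
    rw [← hper] at h
    exact h
  · rw [← Function.iterate_add_apply, add_comm, Function.iterate_add_apply, hpn]

lemma isClosed_Cbar : IsClosed Cbar := by
  have h : Cbar = {p : ℝ × ℝ × ℝ | p.2.1 ≤ p.1} ∩ ({p | p.2.2 ≤ p.2.1} ∩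
      ({p | 0 ≤ p.2.2} ∩ {p | p.1 + p.2.1 + p.2.2 = 1})) := by
    ext p; rfl
  rw [h]
  refine (isClosed_le (by fun_prop) (by fun_prop)).inter
    ((isClosed_le (by fun_prop) (by fun_prop)).inter
    ((isClosed_le (by fun_prop) (by fun_prop)).inter
    (isClosed_eq (by fun_prop) (by fun_prop))))

lemma Ibr_mem_Cbar (i : Fin 4) {p : ℝ × ℝ × ℝ} (hp : p ∈ Cbar) : Ibr i p ∈ Cbar := by
  obtain ⟨h1, h2, h3, h4⟩ := hp
  fin_cases i <;> refine ⟨?_, ?_, ?_, ?_⟩ <;> simp only [Ibr] <;> linarith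

lemma dist_Ibr_le (i : Fin 4) (p q : ℝ × ℝ × ℝ) :
    dist (Ibr i p) (Ibr i q) ≤ 1 / 2 * dist p q := by
  have h1 : |p.1 - q.1| ≤ dist p q := by
    rw [← Real.dist_eq]; exact le_max_left _ _
  have h2 : |p.2.1 - q.2.1| ≤ dist p q := by
    rw [← Real.dist_eq]; exact (le_max_left _ _).trans (le_max_right _ _)
  have h3 : |p.2.2 - q.2.2| ≤ dist p q := by
    rw [← Real.dist_eq]; exact (le_max_right _ _).trans (le_max_right _ _)
  rw [abs_le] at h1 h2 h3
  fin_cases i <;> simp only [Ibr] <;> refine max_le ?_ (max_le ?_ ?_) <;>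
    simp only [Real.dist_eq] <;> rw [abs_le] <;> constructor <;> linarith

/-- Every cyclic word is realised by a cycle of inverse branches in `C̄`. -/
lemma exists_inverse_cycle {n : ℕ} (hn : 1 ≤ n) (w : Fin n → Fin 4) :
    ∃ x : Fin n → ℝ × ℝ × ℝ, (∀ j, x j ∈ Cbar) ∧
      ∀ j, x j = Ibr (w j) (x ⟨(j.val + 1) % n, Nat.mod_lt _ hn⟩) := by
  let F : (Fin n → ℝ × ℝ × ℝ) → Fin n → ℝ × ℝ × ℝ := fun x j =>
    Ibr (w j) (x ⟨(j.val + 1) % n, Nat.mod_lt _ hn⟩)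
  let s : Set (Fin n → ℝ × ℝ × ℝ) := Set.univ.pi fun _ => Cbar
  have hs : IsComplete s := (isClosed_set_pi fun _ _ => isClosed_Cbar).isComplete
  have hF : LipschitzWith (1 / 2) F := by
    refine LipschitzWith.of_dist_le_mul fun x y => ?_
    rw [dist_pi_le_iff (by positivity)]
    intro j
    refine (dist_Ibr_le _ _ _).trans ?_
    push_cast
    gcongr
    exact dist_le_pi_dist x y _
  have hmaps : Set.MapsTo F s s := fun x hx j _ => Ibr_mem_Cbar _ (hx _ trivial)
  have hcontr : ContractingWith (1 / 2) (hmaps.restrict F s s) :=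
    ⟨NNReal.half_lt_self one_ne_zero, fun x y => hF x y⟩
  have hmem : (fun _ => (1, 0, 0)) ∈ s := fun _ _ => by
    refine ⟨?_, ?_, ?_, ?_⟩ <;> norm_num
  obtain ⟨x, hx, hfix, -⟩ := hcontr.exists_fixedPoint' hs hmaps hmem (edist_ne_top _ _)
  exact ⟨x, fun j => hx j trivial, fun j => (congrFun hfix j).symm⟩

lemma pedal_Ibr (i : Fin 4) {p : ℝ × ℝ × ℝ} (hp : p ∈ Cset) : pedal (Ibr i p) = p := by
  obtain ⟨a, b, c⟩ := p
  obtain ⟨h1, h2, h3, h4⟩ := hp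
  simp only at h1 h2 h3 h4
  unfold pedal
  fin_cases i <;> split_ifs <;> simp only [Ibr] at * <;>
    refine Prod.ext ?_ (Prod.ext ?_ ?_) <;> simp only <;> linarith

/-- A triple with two equal adjacent entries. -/
def IsIsosceles (p : ℝ × ℝ × ℝ) : Prop := p.1 = p.2.1 ∨ p.2.1 = p.2.2

lemma IsIsosceles.pedal {p : ℝ × ℝ × ℝ} (hp : p ∈ Cset) (h : IsIsosceles p) :
    IsIsosceles (pedal p) := by
  obtain ⟨a, b, c⟩ := p
  obtain ⟨h1, h2, h3, h4⟩ := hp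
  simp only [IsIsosceles, _root_.pedal] at *
  grind

lemma pedal_equilateral : pedal (1 / 3, 1 / 3, 1 / 3) = (1 / 3, 1 / 3, 1 / 3) := by
  norm_num [pedal]

/-- An inverse branch lands in the prescribed region unless there is a tie, which is excluded
when isosceles and equilateral shapes are preserved. -/
lemma Ibr_mem_Rset (i : Fin 4) {q : ℝ × ℝ × ℝ} (hq : q ∈ Cset) (hI : Ibr i q ∈ Cset)
    (hiso : IsIsosceles q → IsIsosceles (Ibr i q))
    (hequi : q = (1 / 3, 1 / 3, 1 / 3) → Ibr i q = (1 / 3, 1 / 3, 1 / 3)) :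
    Ibr i q ∈ Rset i := by
  obtain ⟨a, b, c⟩ := q
  obtain ⟨h1, h2, h3, h4⟩ := hq
  simp only at h1 h2 h3 h4
  have hne : a = b → b = c → Ibr i (a, b, c) = (1 / 3, 1 / 3, 1 / 3) := fun hab hbc =>
    hequi (Prod.ext (by simp only; linarith) (Prod.ext (by simp only; linarith)
      (by simp only; linarith)))
  fin_cases i
  · exact ⟨⟨hI, ne_of_lt (by simp only [Ibr]; linarith)⟩, by simp only [Ibr]; linarith⟩
  · exact ⟨⟨hI, ne_of_gt (by simp only [Ibr]; linarith)⟩, by simp only [Ibr]; linarith,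
      by simp only [Ibr]; linarith⟩
  · have hab : a ≠ b := fun hab => by
      rcases hiso (Or.inl hab) with h | h <;> simp only [Ibr] at h
      · linarith
      · have := congrArg Prod.fst (hne hab (by linarith))
        simp only [Ibr] at this
        linarith
    have hlt := lt_of_le_of_ne h1 hab.symm
    exact ⟨⟨hI, ne_of_gt (by simp only [Ibr]; linarith)⟩, by simp only [Ibr]; linarith,
      by simp only [Ibr]; linarith, by simp only [Ibr]; linarith⟩
  · have hbc : b ≠ c := fun hbc => by
      rcases hiso (Or.inr hbc) with h | h <;> simp only [Ibr] at h
      · linarith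
      · have := congrArg Prod.fst (hne (by linarith) hbc)
        simp only [Ibr] at this
        linarith
    have hlt := lt_of_le_of_ne h2 hbc.symm
    exact ⟨⟨hI, ne_of_gt (by simp only [Ibr]; linarith)⟩, by simp only [Ibr]; linarith,
      by simp only [Ibr]; linarith⟩

/-- On a periodic sequence of inverse branches in `C`, each point lies in the region
prescribed by its branch: a tie would force the whole cycle to be isosceles. -/
lemma mem_Rset_of_cycle {n : ℕ} (hn : 1 ≤ n) {u : ℕ → Fin 4} {x : ℕ → ℝ × ℝ × ℝ}
    (hx : ∀ k, x k ∈ Cset) (hxn : ∀ k, x (k + n) = x k)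
    (hI : ∀ k, x k = Ibr (u k) (x (k + 1))) (k : ℕ) : x k ∈ Rset (u k) := by
  have hped : ∀ k, pedal (x k) = x (k + 1) := fun k => by
    rw [hI k, pedal_Ibr _ (hx _)]
  have hback : ∀ Q : ℝ × ℝ × ℝ → Prop, (∀ m, Q (x m) → Q (x (m + 1))) →
      Q (x (k + 1)) → Q (x k) := by
    intro Q hstep h0
    have hall : ∀ m, Q (x (k + 1 + m)) := by
      intro m
      induction m with
      | zero => exact h0
      | succ m ih => exact hstep _ ih
    rw [← hxn k]
    have := hall (n - 1)
    rwa [show k + 1 + (n - 1) = k + n by omega] at this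
  have hiso := hback IsIsosceles fun m hm => hped m ▸ hm.pedal (hx m)
  have hequi := hback (· = (1 / 3, 1 / 3, 1 / 3)) fun m hm => by
    rw [← hped m, hm, pedal_equilateral]
  rw [hI k] at hiso hequi ⊢
  exact Ibr_mem_Rset _ (hx _) (hI k ▸ hx k) hiso hequi

/-- On a periodic sequence of inverse branches in `C̄` using branch `0` or `3`, no point is
degenerate. -/
lemma mem_Cset_of_cycle {n : ℕ} (hn : 1 ≤ n) {u : ℕ → Fin 4} {x : ℕ → ℝ × ℝ × ℝ}
    (hx : ∀ k, x k ∈ Cbar) (hun : ∀ k, u (k % n) = u k)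
    (hI : ∀ k, x k = Ibr (u k) (x (k + 1))) (hu : ∃ j, u j = 0 ∨ u j = 3) (k : ℕ) :
    x k ∈ Cset := by
  obtain ⟨j, hj⟩ := hu
  have hforward : ∀ Q : ℝ × ℝ × ℝ → Prop,
      (∀ m, Q (x m) → (u m ≠ 0 ∧ u m ≠ 3) ∧ Q (x (m + 1))) → ∀ k, ¬ Q (x k) := by
    intro Q hstep k h0
    have hall : ∀ m, Q (x (k + m)) := by
      intro m
      induction m with
      | zero => exact h0
      | succ m ih => exact (hstep _ ih).2
    have hle : k ≤ j + n * k := by nlinarith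
    have h := (hstep _ (hall (j + n * k - k))).1
    rw [Nat.add_sub_cancel' hle, ← hun, Nat.add_mul_mod_self_left, hun] at h
    exact hj.elim h.1 h.2
  have ha : ∀ k, ¬ (x k).1 = 1 := by
    apply hforward (fun p => p.1 = 1)
    intro m hm
    obtain ⟨h1, h2, h3, h4⟩ := hx (m + 1)
    rw [hI m] at hm
    generalize u m = i at *
    fin_cases i <;> simp [Ibr] at hm ⊢ <;> linarith
  have hc : ∀ k, ¬ (x k).2.2 = 0 := by
    apply hforward (fun p => p.2.2 = 0)
    intro m hm
    obtain ⟨h1, h2, h3, h4⟩ := hx (m + 1)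
    have ha' := ha (m + 1)
    rw [hI m] at hm
    generalize u m = i at *
    fin_cases i <;> simp [Ibr] at hm ⊢ <;> grind
  obtain ⟨h1, h2, h3, h4⟩ := hx k
  exact ⟨h1, h2, lt_of_le_of_ne h3 (Ne.symm (hc k)), h4⟩

lemma exists_mem_Tset_of_prim2D {n : ℕ} (hn : 1 ≤ n) {w : Fin n → Fin 4}
    (hw : Prim2D n (etaHat w)) : ∃ p ∈ Tset n, Itinerary n p w := by
  obtain ⟨y, hy, hyI⟩ := exists_inverse_cycle hn w
  let r : ℕ → Fin n := fun k => ⟨k % n, Nat.mod_lt _ hn⟩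
  let u : ℕ → Fin 4 := fun k => w (r k)
  let x : ℕ → ℝ × ℝ × ℝ := fun k => y (r k)
  have hr : ∀ j : Fin n, r j = j := fun j => Fin.ext (Nat.mod_eq_of_lt j.isLt)
  have hI : ∀ k, x k = Ibr (u k) (x (k + 1)) := by
    intro k
    have h := hyI (r k)
    simpa [r, x, u] using h
  have hxC : ∀ k, x k ∈ Cset := by
    apply mem_Cset_of_cycle hn (fun k => hy _) (u := u) (by simp [u, r]) hI
    obtain ⟨j, hj⟩ := hw.exists_eq_zero_or_three hn
    exact ⟨j, by simpa only [u, hr] using hj⟩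
  have hxn : ∀ k, x (k + n) = x k := by simp [x, r]
  have hR := mem_Rset_of_cycle hn hxC hxn hI
  have hiter : ∀ k, pedal^[k] (x 0) = x k := by
    intro k
    induction k with
    | zero => rfl
    | succ k ih =>
      rw [Function.iterate_succ_apply', ih, hI k, pedal_Ibr _ (hxC _)]
  have hper : pedal^[n] (x 0) = x 0 := by
    rw [hiter]; simpa using hxn 0
  refine ⟨x 0, ⟨hxC 0, fun j _ => ?_, hper, fun d hd hdn hdp => ?_⟩, fun j => ?_⟩
  · rw [hiter]
    exact Rset_subset_Cstar _ (hR j)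
  · have hq0 : 0 < Function.minimalPeriod pedal (x 0) :=
      Function.IsPeriodicPt.minimalPeriod_pos hn hper
    have hqn : Function.minimalPeriod pedal (x 0) < n :=
      (Function.IsPeriodicPt.minimalPeriod_le hd hdp).trans_lt hdn
    refine hw.not_periodic hq0 hqn (Function.IsPeriodicPt.minimalPeriod_dvd hper) fun j => ?_
    have h1 := hR (j.val % Function.minimalPeriod pedal (x 0))
    rw [← hiter (_ % _), Function.iterate_mod_minimalPeriod_eq, hiter] at h1
    have h2 := Rset_unique (hR j) h1
    simp only [u, hr] at h2
    rw [h2]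
    exact congrArg w (Fin.ext (Nat.mod_eq_of_lt ((Nat.mod_lt _ hq0).trans hqn)))
  · rw [hiter]
    simpa only [u, hr] using hR j

/-- The composite `η̂ ∘ ι` is a bijection from `T_n` onto `W_n`: every `p ∈ T_n` has a
branch itinerary; the image `η̂(ι(p))` lies in `W_n`; the assignment is injective; and every
`W ∈ W_n` arises as `η̂(ι(p))` for some `p ∈ T_n`. -/
theorem stmt18 (n : ℕ) (hn : 1 ≤ n) :
    (∀ p ∈ Tset n, ∃ w : Fin n → Fin 4, Itinerary n p w) ∧
    (∀ p ∈ Tset n, ∀ w : Fin n → Fin 4, Itinerary n p w → etaHat w ∈ Wset n) ∧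
    (∀ p ∈ Tset n, ∀ p' ∈ Tset n, ∀ w w' : Fin n → Fin 4,
        Itinerary n p w → Itinerary n p' w' → etaHat w = etaHat w' → p = p') ∧
    (∀ W ∈ Wset n, ∃ p ∈ Tset n, ∃ w : Fin n → Fin 4, Itinerary n p w ∧ etaHat w = W) := by
  refine ⟨fun p hp => ?_, fun p hp w hw => ?_, fun p hp p' hp' w w' hw hw' h => ?_,
    fun W hW => ?_⟩
  · choose w hw using fun j : Fin n => exists_mem_Rset (hp.2.1 j j.isLt)
    exact ⟨w, hw⟩
  · exact prim2D_etaHat (hw.prim1D hp) (hw.exists_eq_zero_or_three hn hp.1 hp.2.2.1)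
  · have hww : w = w' := funext fun j => eta_injective (funext fun i => congrFun (congrFun h i) j)
    subst hww
    exact eq_of_itinerary_eq hn hw hw' hp.2.2.1 hp'.2.2.1
  · choose w hw using fun j : Fin n => eta_surjective fun i => W i j
    have hWw : etaHat w = W := funext fun i => funext fun j => congrFun (hw j) i
    obtain ⟨p, hp, hpw⟩ := exists_mem_Tset_of_prim2D hn (w := w) (by rw [hWw]; exact hW)
    exact ⟨p, hp, w, hpw, hWw⟩
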